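/- arXiv:1805.07955 — 3 statements merged into one kernel-verified Lean document; each statement's English description precedes it below -/
import Mathlib

section
/- Let φ : (0,∞) → (0,∞) satisfy the weak scaling condition with constants a ≥ 1 and 0 < σ̲ ≤ σ̄ < 2. Then for every R > 0 and every t ∈ (0,1) one has \underline{C}_φ(R)/\underline{C}_φ(tR) ≤ 1 + a² t^{−2+σ̲}. -/
open MeasureTheory Metric Filter Set
open scoped Classical

noncomputable section

abbrev En (n : ℕ) : Type := EuclideanSpace ℝ (Fin n)

def WSC (φ : ℝ → ℝ) (a σl σu : ℝ) : Prop :=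
  (∀ r : ℝ, 0 < r → 0 < φ r) ∧
  ∀ r R : ℝ, 0 < r → r ≤ R →
    a⁻¹ * (R / r) ^ σl ≤ φ R / φ r ∧ φ R / φ r ≤ a * (R / r) ^ σu

def Cund (φ : ℝ → ℝ) (R : ℝ) : ℝ := ∫ r in Ioo (0:ℝ) R, r / φ r

def Cov (φ : ℝ → ℝ) (R : ℝ) : ℝ := ∫ r in Ioi R, 1 / (r * φ r)

def Cphi (n : ℕ) [NeZero n] (φ : ℝ → ℝ) : ℝ :=
  (∫ y : En n, (1 - Real.cos (y 0)) / (‖y‖ ^ n * φ ‖y‖))⁻¹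

def dd {n : ℕ} (u : En n → ℝ) (x y : En n) : ℝ := u (x + y) + u (x - y) - 2 * u x

def Mp (n : ℕ) [NeZero n] (φ : ℝ → ℝ) (lam Lam : ℝ) (u : En n → ℝ) (x : En n) : ℝ :=
  Cphi n φ * ∫ y : En n, (Lam * max (dd u x y) 0 - lam * max (-(dd u x y)) 0) / (‖y‖ ^ n * φ ‖y‖)

def Mm (n : ℕ) [NeZero n] (φ : ℝ → ℝ) (lam Lam : ℝ) (u : En n → ℝ) (x : En n) : ℝ :=
  Cphi n φ * ∫ y : En n, (lam * max (dd u x y) 0 - Lam * max (-(dd u x y)) 0) / (‖y‖ ^ n * φ ‖y‖)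

def Bdd {α : Type*} (u : α → ℝ) : Prop := ∃ M : ℝ, ∀ x, |u x| ≤ M

def ViscLE {n : ℕ} (I : (En n → ℝ) → En n → ℝ) (u : En n → ℝ) (Ω : Set (En n))
    (f : En n → ℝ) : Prop :=
  ∀ x ∈ Ω, ∀ N : Set (En n), IsOpen N → x ∈ N → N ⊆ Ω →
    ∀ ψ : En n → ℝ, ContDiff ℝ 2 ψ → ψ x = u x → (∀ z ∈ N, z ≠ x → ψ z < u z) →
      I (fun z => if z ∈ N then ψ z else u z) x ≤ f x

def ViscGE {n : ℕ} (I : (En n → ℝ) → En n → ℝ) (u : En n → ℝ) (Ω : Set (En n))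
    (f : En n → ℝ) : Prop :=
  ∀ x ∈ Ω, ∀ N : Set (En n), IsOpen N → x ∈ N → N ⊆ Ω →
    ∀ ψ : En n → ℝ, ContDiff ℝ 2 ψ → ψ x = u x → (∀ z ∈ N, z ≠ x → u z < ψ z) →
      f x ≤ I (fun z => if z ∈ N then ψ z else u z) x

def ωn (n : ℕ) : ℝ := (volume (ball (0 : En n) 1)).toReal

def cube (n : ℕ) (R : ℝ) : Set (En n) := {x | ∀ i, |x i| < R / 2}

/-- Lower scaling controls the integrand of `Cund` from below under dilation by `t < 1`. -/
lemma WSC.div_le_div_comp_mul {φ : ℝ → ℝ} {a σl σu : ℝ} (ha : 0 < a) (hφ : WSC φ a σl σu)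
    {t s : ℝ} (ht0 : 0 < t) (ht1 : t ≤ 1) (hs : 0 < s) :
    s / φ s ≤ a * t ^ (-1 + σl) * (t * s / φ (t * s)) := by
  have hts : 0 < t * s := mul_pos ht0 hs
  have h1 : 0 < φ s := hφ.1 s hs
  have h2 : 0 < φ (t * s) := hφ.1 _ hts
  have h := (hφ.2 (t * s) s hts (by nlinarith)).1
  have hq : s / (t * s) = t⁻¹ := by field_simp
  have hp : 0 < t ^ σl := Real.rpow_pos_of_pos ht0 _
  rw [hq, Real.inv_rpow ht0.le, ← mul_inv, inv_le_comm₀ (by positivity) (by positivity), inv_div,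
    div_le_iff₀ h1] at h
  rw [Real.rpow_add ht0, Real.rpow_neg_one]
  have e : a * (t⁻¹ * t ^ σl) * (t * s / φ (t * s)) = a * t ^ σl * s / φ (t * s) := by
    field_simp
  rw [e, div_le_div_iff₀ h1 h2]
  nlinarith [mul_le_mul_of_nonneg_left h hs.le]

lemma Cund_eq_intervalIntegral (φ : ℝ → ℝ) {R : ℝ} (hR : 0 ≤ R) :
    Cund φ R = ∫ r in (0 : ℝ)..R, r / φ r := by
  rw [Cund, intervalIntegral.integral_of_le hR, integral_Ioc_eq_integral_Ioo]

lemma WSC.Cund_nonneg {φ : ℝ → ℝ} {a σl σu : ℝ} (hφ : WSC φ a σl σu) (R : ℝ) :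
    0 ≤ Cund φ R :=
  setIntegral_nonneg measurableSet_Ioo fun r hr => div_nonneg hr.1.le (hφ.1 r hr.1).le

/-- No measurability of `φ` is needed: if the integrand is not integrable, then `Cund φ R = 0`. -/
lemma WSC.Cund_le_mul_Cund {φ : ℝ → ℝ} {a σl σu : ℝ} (ha : 0 < a) (hφ : WSC φ a σl σu)
    {R t : ℝ} (hR : 0 < R) (ht0 : 0 < t) (ht1 : t ≤ 1) :
    Cund φ R ≤ a * t ^ (-2 + σl) * Cund φ (t * R) := by
  by_cases hi : IntegrableOn (fun r => r / φ r) (Ioo 0 R)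
  · have hI : IntervalIntegrable (fun r => r / φ r) volume 0 R :=
      (intervalIntegrable_iff_integrableOn_Ioo_of_le hR.le).2 hi
    have hI' : IntervalIntegrable (fun r => r / φ r) volume 0 (t * R) :=
      (intervalIntegrable_iff_integrableOn_Ioo_of_le (by positivity)).2
        (hi.mono_set (Ioo_subset_Ioo_right (by nlinarith)))
    have hJ : IntervalIntegrable (fun s => t * s / φ (t * s)) volume 0 R := by
      simpa [ht0.ne'] using hI'.comp_mul_left (c := t)
    have hle := intervalIntegral.integral_mono_on_of_le_Ioo hR.le hI
      (hJ.const_mul (a * t ^ (-1 + σl)))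
      fun s hs => hφ.div_le_div_comp_mul ha ht0 ht1 hs.1
    rw [intervalIntegral.integral_const_mul,
      intervalIntegral.integral_comp_mul_left (fun r => r / φ r) ht0.ne', mul_zero,
      ← Cund_eq_intervalIntegral φ hR.le, ← Cund_eq_intervalIntegral φ (by positivity),
      smul_eq_mul] at hle
    have e : t ^ (-2 + σl) = t ^ (-1 + σl) * t⁻¹ := by
      rw [← Real.rpow_neg_one t, ← Real.rpow_add ht0]
      ring_nf
    rw [e]
    linarith
  · rw [Cund, integral_undef hi]
    have := hφ.Cund_nonneg (t * R)
    positivity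

theorem stmt2 (φ : ℝ → ℝ) (a σl σu : ℝ) (ha : 1 ≤ a) (hσl : 0 < σl) (hσ : σl ≤ σu)
    (hσu : σu < 2) (hφ : WSC φ a σl σu) :
    ∀ R : ℝ, 0 < R → ∀ t ∈ Ioo (0:ℝ) 1,
      Cund φ R / Cund φ (t * R) ≤ 1 + a ^ 2 * t ^ (-2 + σl) := by
  intro R hR t ht
  have hp : 0 < t ^ (-2 + σl) := Real.rpow_pos_of_pos ht.1 _
  have hC := hφ.Cund_nonneg (t * R)
  refine div_le_of_le_mul₀ hC (by positivity) ?_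
  refine (hφ.Cund_le_mul_Cund (by linarith) hR ht.1 ht.2.le).trans ?_
  gcongr
  have ha2 : a ≤ a ^ 2 := le_self_pow₀ ha two_ne_zero
  linarith [mul_le_mul_of_nonneg_right ha2 hp.le]
end
end

section
/- Let n ≥ 2 and let φ : (0,∞) → (0,∞) satisfy the weak scaling condition with constants a ≥ 1 and 0 < σ̲ ≤ σ̄ < 2. Then the constant C_φ admits the representation C_φ⁻¹ = ∫_{ℝ^{n−1}} ( ∫_ℝ (1 − cos(r/ζ(y'))) / (|r| φ(|r|)) dr ) · dy'/ζ(y')ⁿ, where ζ(y') = (1 + |y'|²)^{1/2}. -/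
open MeasureTheory Metric Filter Set
open scoped Classical

noncomputable section

/-- The identity on `ℝ`, with the value at `0` replaced by `1` so that it never vanishes. -/
def jacobianPivot (x : ℝ) : ℝ := if x = 0 then 1 else x

lemma jacobianPivot_ne_zero (x : ℝ) : jacobianPivot x ≠ 0 := by
  unfold jacobianPivot; split_ifs <;> simp_all

lemma jacobianPivot_of_ne_zero {x : ℝ} (hx : x ≠ 0) : jacobianPivot x = x := if_neg hx

lemma measurable_jacobianPivot : Measurable jacobianPivot :=
  Measurable.ite (measurableSet_singleton 0) measurable_const measurable_id

/-- The Japanese bracket `ζ(v) = (1 + |v|²)^{1/2}`. -/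
def bracket {m : ℕ} (v : En m) : ℝ := Real.sqrt (1 + ‖v‖ ^ 2)

lemma bracket_pos {m : ℕ} (v : En m) : 0 < bracket v := Real.sqrt_pos.2 (by positivity)

lemma bracket_sq {m : ℕ} (v : En m) : bracket v ^ 2 = 1 + ‖v‖ ^ 2 := Real.sq_sqrt (by positivity)

lemma measurable_bracket {m : ℕ} : Measurable (bracket (m := m)) := by
  unfold bracket; fun_prop

/-- The change of variables `(y', r) ↦ (r / ζ(y'), (r / ζ(y')) y')`, extended bijectively across
`r = 0`. -/
def projectiveEquiv (m : ℕ) : En m × ℝ ≃ᵐ ℝ × En m where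
  toFun p := (p.2 / bracket p.1, jacobianPivot (p.2 / bracket p.1) • p.1)
  invFun q := ((jacobianPivot q.1)⁻¹ • q.2, q.1 * bracket ((jacobianPivot q.1)⁻¹ • q.2))
  left_inv p := by
    simp [smul_smul, inv_mul_cancel₀ (jacobianPivot_ne_zero _),
      div_mul_cancel₀ _ (bracket_pos p.1).ne']
  right_inv q := by
    have h := (bracket_pos ((jacobianPivot q.1)⁻¹ • q.2)).ne'
    simp [smul_smul, mul_inv_cancel₀ (jacobianPivot_ne_zero _), mul_div_cancel_right₀ _ h]
  measurable_toFun := by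
    have := measurable_bracket (m := m)
    have := measurable_jacobianPivot
    simp only [Equiv.coe_fn_mk]
    fun_prop
  measurable_invFun := by
    have := measurable_bracket (m := m)
    have := measurable_jacobianPivot
    simp only [Equiv.coe_fn_symm_mk]
    fun_prop

lemma lintegral_comp_smul_addHaar {m : ℕ} {c : ℝ} (hc : c ≠ 0) (g : En m → ENNReal) :
    ∫⁻ v, g v = ENNReal.ofReal (|c| ^ m) * ∫⁻ v, g (c • v) := by
  have h := Measure.map_addHaar_smul (volume : Measure (En m)) hc
  have he := (MeasurableEquiv.smul₀ c hc : En m ≃ᵐ En m).measurableEmbedding.lintegral_map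
    (μ := volume) g
  simp only [MeasurableEquiv.coe_smul₀] at he
  rw [← he, h, lintegral_smul_measure, smul_eq_mul, ← mul_assoc, ← ENNReal.ofReal_mul (by positivity)]
  simp [abs_inv, abs_pow, hc]

/-- The Jacobian of `projectiveEquiv`. -/
def projectiveDensity {m : ℕ} (p : En m × ℝ) : NNReal :=
  Real.toNNReal (|jacobianPivot (p.2 / bracket p.1)| ^ m * (bracket p.1)⁻¹)

lemma measurable_projectiveDensity {m : ℕ} : Measurable (projectiveDensity (m := m)) := by
  have := measurable_bracket (m := m)
  have := measurable_jacobianPivot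
  unfold projectiveDensity
  fun_prop

lemma lintegral_comp_div {c : ℝ} (hc : 0 < c) (g : ℝ → ENNReal) :
    ∫⁻ x, g x = ENNReal.ofReal c⁻¹ * ∫⁻ r, g (r / c) := by
  have h := Measure.map_addHaar_smul (volume : Measure ℝ) (inv_ne_zero hc.ne')
  have he := (MeasurableEquiv.smul₀ c⁻¹ (inv_ne_zero hc.ne') :
    ℝ ≃ᵐ ℝ).measurableEmbedding.lintegral_map (μ := volume) g
  simp only [MeasurableEquiv.coe_smul₀] at he
  simp only [smul_eq_mul] at he h
  simp_rw [div_eq_inv_mul]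
  rw [← he, h, lintegral_smul_measure, smul_eq_mul, ← mul_assoc,
    ← ENNReal.ofReal_mul (by positivity)]
  simp [abs_of_pos hc, hc.ne']

lemma map_projectiveEquiv (m : ℕ) :
    ((volume : Measure (En m × ℝ)).withDensity (fun p => (projectiveDensity p : ENNReal))).map
      (projectiveEquiv m) = volume := by
  have hb := measurable_bracket (m := m)
  have hp := measurable_jacobianPivot
  refine Measure.ext_of_lintegral _ fun g hg => ?_
  rw [lintegral_map hg (projectiveEquiv m).measurable,
    lintegral_withDensity_eq_lintegral_mul _ measurable_projectiveDensity.coe_nnreal_ennreal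
      (g := fun p => g (projectiveEquiv m p)) (hg.comp (projectiveEquiv m).measurable),
    Measure.volume_eq_prod, Measure.volume_eq_prod,
    lintegral_prod _ (Measurable.aemeasurable ?_), lintegral_prod _ hg.aemeasurable]
  swap
  · exact measurable_projectiveDensity.coe_nnreal_ennreal.mul
      (hg.comp (projectiveEquiv m).measurable)
  have hF : Measurable fun q : ℝ × En m =>
      ENNReal.ofReal (|jacobianPivot q.1| ^ m) * g (q.1, jacobianPivot q.1 • q.2) := by
    fun_prop
  have h1 : ∀ x : ℝ, ∫⁻ v, g (x, v) =
      ∫⁻ v, ENNReal.ofReal (|jacobianPivot x| ^ m) * g (x, jacobianPivot x • v) := fun x => by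
    rw [lintegral_comp_smul_addHaar (jacobianPivot_ne_zero x), lintegral_const_mul]
    fun_prop
  simp_rw [h1]
  rw [← lintegral_lintegral_swap (f := fun v x => ENNReal.ofReal (|jacobianPivot x| ^ m) *
    g (x, jacobianPivot x • v)) (hF.comp measurable_swap).aemeasurable]
  refine lintegral_congr fun v => ?_
  rw [lintegral_comp_div (bracket_pos v) fun x => ENNReal.ofReal (|jacobianPivot x| ^ m) *
    g (x, jacobianPivot x • v), ← lintegral_const_mul]
  swap
  · fun_prop
  refine lintegral_congr fun r => ?_
  have : (projectiveDensity (v, r) : ENNReal) = ENNReal.ofReal (bracket v)⁻¹ *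
      ENNReal.ofReal (|jacobianPivot (r / bracket v)| ^ m) := by
    rw [← ENNReal.ofReal_mul (inv_nonneg.2 (bracket_pos v).le), mul_comm]
    rfl
  simp only [Pi.mul_apply, this, mul_assoc]
  rfl

/-- The splitting of Euclidean space into the first and the remaining coordinates. -/
def consEquiv (m : ℕ) : ℝ × En m ≃ᵐ En (m + 1) :=
  ((MeasurableEquiv.refl ℝ).prodCongr (MeasurableEquiv.toLp 2 (Fin m → ℝ)).symm).trans
    ((MeasurableEquiv.piFinSuccAbove (fun _ : Fin (m + 1) => ℝ) 0).symm.trans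
      (MeasurableEquiv.toLp 2 (Fin (m + 1) → ℝ)))

lemma measurePreserving_consEquiv (m : ℕ) : MeasurePreserving (consEquiv m) :=
  (PiLp.volume_preserving_toLp (Fin (m + 1))).comp
    (((volume_preserving_piFinSuccAbove (fun _ : Fin (m + 1) => ℝ) 0).symm _).comp
      ((MeasurePreserving.id (volume : Measure ℝ)).prod
        (EuclideanSpace.volume_preserving_symm_measurableEquiv_toLp (Fin m))))

lemma consEquiv_zero {m : ℕ} (q : ℝ × En m) : consEquiv m q 0 = q.1 := rfl

lemma consEquiv_succ {m : ℕ} (q : ℝ × En m) (i : Fin m) : consEquiv m q i.succ = q.2 i := rfl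

lemma norm_consEquiv_sq {m : ℕ} (q : ℝ × En m) : ‖consEquiv m q‖ ^ 2 = q.1 ^ 2 + ‖q.2‖ ^ 2 := by
  simp [EuclideanSpace.norm_sq_eq, Fin.sum_univ_succ, consEquiv_zero, consEquiv_succ]

lemma integral_eq_integral_projective {m : ℕ} (f : En (m + 1) → ℝ) :
    ∫ y, f y = ∫ p : En m × ℝ,
      (projectiveDensity p : ℝ) * f (consEquiv m (projectiveEquiv m p)) := by
  rw [← (measurePreserving_consEquiv m).integral_comp (consEquiv m).measurableEmbedding,
    ← map_projectiveEquiv m, (projectiveEquiv m).measurableEmbedding.integral_map,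
    integral_withDensity_eq_integral_smul measurable_projectiveDensity]
  rfl

lemma norm_consEquiv_projectiveEquiv {m : ℕ} (v : En m) {r : ℝ} (hr : r ≠ 0) :
    ‖consEquiv m (projectiveEquiv m (v, r))‖ = |r| := by
  have hb := (bracket_pos v).ne'
  have hx : r / bracket v ≠ 0 := div_ne_zero hr hb
  rw [← sq_eq_sq₀ (norm_nonneg _) (abs_nonneg _), norm_consEquiv_sq, sq_abs]
  simp only [projectiveEquiv, MeasurableEquiv.coe_mk, Equiv.coe_fn_mk,
    jacobianPivot_of_ne_zero hx, norm_smul, Real.norm_eq_abs, mul_pow, sq_abs]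
  have := bracket_sq v
  field_simp
  linarith

lemma integral_eq_integral_projective_kernel {m : ℕ} (φ : ℝ → ℝ) :
    ∫ y : En (m + 1), (1 - Real.cos (y 0)) / (‖y‖ ^ (m + 1) * φ ‖y‖) =
      ∫ p : En m × ℝ, (1 - Real.cos (p.2 / bracket p.1)) / (|p.2| * φ |p.2|) /
        bracket p.1 ^ (m + 1) := by
  rw [integral_eq_integral_projective]
  have h0 : ∀ᵐ p : En m × ℝ, p.2 ≠ 0 :=
    Measure.quasiMeasurePreserving_snd.ae (Measure.ae_ne volume 0)
  refine integral_congr_ae ?_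
  filter_upwards [h0] with ⟨v, r⟩ hr
  have hb := bracket_pos v
  have hr' : 0 < |r| := abs_pos.2 hr
  have hx : r / bracket v ≠ 0 := div_ne_zero hr hb.ne'
  rw [norm_consEquiv_projectiveEquiv v hr, consEquiv_zero]
  simp only [projectiveEquiv, projectiveDensity, MeasurableEquiv.coe_mk, Equiv.coe_fn_mk]
  rw [jacobianPivot_of_ne_zero hx, Real.coe_toNNReal _ (by positivity), abs_div, abs_of_pos hb, div_pow, pow_succ |r|, pow_succ (bracket v)]
  field_simp

lemma integrable_of_even {k : ℝ → ℝ} (hk : ∀ r, k (-r) = k r) (h : IntegrableOn k (Ioi 0)) :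
    Integrable k := by
  have hIic : IntegrableOn k (Iic 0) := by
    have hneg : MeasurableEmbedding fun x : ℝ => -x := (Homeomorph.neg ℝ).measurableEmbedding
    rw [← Measure.map_neg_eq_self (volume : Measure ℝ), hneg.integrableOn_map_iff]
    simpa [Function.comp_def, hk, integrableOn_Ici_iff_integrableOn_Ioi] using h
  simpa [Iic_union_Ioi] using hIic.union h

lemma integrable_one_sub_cos_div {φ : ℝ → ℝ} {a σl σu : ℝ} (ha : 1 ≤ a) (hσl : 0 < σl)
    (hσu : σu < 2) (hφ : WSC φ a σl σu)
    (hm : AEStronglyMeasurable (fun r : ℝ => |r| * φ |r|)) {c : ℝ} (hc : 0 < c) :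
    Integrable fun r : ℝ => (1 - Real.cos (r / c)) / (|r| * φ |r|) := by
  have hmeas : AEStronglyMeasurable fun r : ℝ => (1 - Real.cos (r / c)) / (|r| * φ |r|) :=
    (Continuous.aestronglyMeasurable (by fun_prop)).div₀ hm
  have h1 := hφ.1 1 one_pos
  have hnn : ∀ r : ℝ, 0 < r → ‖(1 - Real.cos (r / c)) / (|r| * φ |r|)‖ =
      (1 - Real.cos (r / c)) / (r * φ r) := fun r hr => by
    rw [abs_of_pos hr, Real.norm_of_nonneg]
    exact div_nonneg (sub_nonneg.2 (Real.cos_le_one _)) (mul_pos hr (hφ.1 r hr)).le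
  refine integrable_of_even (fun r => by simp [neg_div]) ?_
  rw [← Ioc_union_Ioi_eq_Ioi zero_le_one]
  refine IntegrableOn.union ?_ ?_
  · have hint : IntegrableOn (fun r : ℝ => a / (2 * c ^ 2 * φ 1) * r ^ (1 - σu)) (Ioc 0 1) :=
      ((intervalIntegrable_iff_integrableOn_Ioc_of_le zero_le_one).1
        (intervalIntegral.intervalIntegrable_rpow' (by linarith))).const_mul _
    refine Integrable.mono' hint hmeas.restrict ?_
    filter_upwards [ae_restrict_mem measurableSet_Ioc] with r hr
    rw [hnn r hr.1]
    have hφr := hφ.1 r hr.1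
    have hcos := Real.one_sub_sq_div_two_le_cos (x := r / c)
    have hW := (hφ.2 r 1 hr.1 hr.2).2
    rw [div_le_iff₀ hφr, one_div, Real.inv_rpow hr.1.le] at hW
    have hp : 0 < r ^ σu := Real.rpow_pos_of_pos hr.1 _
    rw [Real.rpow_sub hr.1, Real.rpow_one]
    calc (1 - Real.cos (r / c)) / (r * φ r) ≤ ((r / c) ^ 2 / 2) / (r * φ r) := by
          have := hr.1
          gcongr
          linarith
      _ = r / (2 * c ^ 2 * φ 1) * (φ 1 / φ r) := by
          have := hr.1.ne'
          field_simp
      _ ≤ r / (2 * c ^ 2 * φ 1) * (a * (r ^ σu)⁻¹) := by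
          have := hr.1
          gcongr
          rwa [div_le_iff₀ hφr]
      _ = a / (2 * c ^ 2 * φ 1) * (r / r ^ σu) := by ring
  · have hint : IntegrableOn (fun r : ℝ => 2 * a / φ 1 * r ^ (-1 - σl)) (Ioi 1) :=
      (integrableOn_Ioi_rpow_of_lt (by linarith) one_pos).const_mul _
    refine Integrable.mono' hint hmeas.restrict ?_
    filter_upwards [ae_restrict_mem measurableSet_Ioi] with r (hr : 1 < r)
    have hr0 : 0 < r := one_pos.trans hr
    rw [hnn r hr0]
    have hφr := hφ.1 r hr0
    have hW := (hφ.2 1 r one_pos hr.le).1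
    have hp : 0 < r ^ σl := Real.rpow_pos_of_pos hr0 _
    have ha0 : 0 < a := one_pos.trans_le ha
    rw [div_one, le_div_iff₀ h1] at hW
    rw [Real.rpow_sub hr0, Real.rpow_neg_one]
    calc (1 - Real.cos (r / c)) / (r * φ r) ≤ 2 / (r * (a⁻¹ * r ^ σl * φ 1)) := by
          gcongr
          linarith [Real.neg_one_le_cos (r / c)]
      _ = 2 * a / φ 1 * (r⁻¹ / r ^ σl) := by field_simp

lemma ae_one_sub_cos_div_ne_zero {c : ℝ} (hc : c ≠ 0) :
    ∀ᵐ r : ℝ, 1 - Real.cos (r / c) ≠ 0 := by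
  have hs : (range fun k : ℤ => (k : ℝ) * (2 * Real.pi) * c).Countable := countable_range _
  filter_upwards [hs.ae_notMem volume] with r hr h0
  obtain ⟨k, hk⟩ := (Real.cos_eq_one_iff (r / c)).1 (sub_eq_zero.1 h0).symm
  exact hr ⟨k, by simp only [hk]; field_simp⟩

lemma aestronglyMeasurable_of_one_sub_cos_div {w : ℝ → ℝ} {c : ℝ} (hc : c ≠ 0)
    (h : AEStronglyMeasurable fun r : ℝ => (1 - Real.cos (r / c)) / w r) :
    AEStronglyMeasurable w := by
  have hcos : AEStronglyMeasurable fun r : ℝ => 1 - Real.cos (r / c) :=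
    Continuous.aestronglyMeasurable (by fun_prop)
  refine (hcos.div₀ h).congr ?_
  filter_upwards [ae_one_sub_cos_div_ne_zero hc] with r hr
  exact div_div_cancel₀ hr

/-- If `φ` is not a.e. measurable, then neither is the integrand on `ℝⁿ` nor any of its
slices, so both sides vanish. -/
theorem integral_one_sub_cos_eq {m : ℕ} {φ : ℝ → ℝ} {a σl σu : ℝ} (ha : 1 ≤ a)
    (hσl : 0 < σl) (hσu : σu < 2) (hφ : WSC φ a σl σu) :
    ∫ y : En (m + 1), (1 - Real.cos (y 0)) / (‖y‖ ^ (m + 1) * φ ‖y‖) =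
      ∫ v : En m, (∫ r : ℝ, (1 - Real.cos (r / bracket v)) / (|r| * φ |r|)) /
        bracket v ^ (m + 1) := by
  rw [integral_eq_integral_projective_kernel]
  simp_rw [← integral_div]
  set F : En m × ℝ → ℝ := fun p => (1 - Real.cos (p.2 / bracket p.1)) / (|p.2| * φ |p.2|) /
    bracket p.1 ^ (m + 1) with hF
  by_cases hm : AEStronglyMeasurable (fun r : ℝ => |r| * φ |r|)
  · have hb := measurable_bracket (m := m)
    have hFm : AEStronglyMeasurable F (volume.prod volume) := by
      refine AEStronglyMeasurable.div₀ (AEStronglyMeasurable.div₀ ?_ hm.comp_snd) ?_ <;>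
      exact Measurable.aestronglyMeasurable (by fun_prop)
    have hF0 : 0 ≤ᵐ[volume.prod volume] F := by
      have h0 : ∀ᵐ p : En m × ℝ, p.2 ≠ 0 :=
        Measure.quasiMeasurePreserving_snd.ae (Measure.ae_ne volume 0)
      filter_upwards [h0] with p hp
      have := bracket_pos p.1
      have := hφ.1 |p.2| (abs_pos.2 hp)
      have := sub_nonneg.2 (Real.cos_le_one (p.2 / bracket p.1))
      simp only [hF, Pi.zero_apply]
      positivity
    have hF0' := Measure.ae_ae_of_ae_prod hF0
    rw [Measure.volume_eq_prod, integral_eq_lintegral_of_nonneg_ae hF0 hFm,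
      lintegral_prod _ hFm.aemeasurable.ennreal_ofReal,
      integral_eq_lintegral_of_nonneg_ae (hF0'.mono fun v hv => integral_nonneg_of_ae hv)
        hFm.integral_prod_right']
    congr 1
    refine lintegral_congr_ae ?_
    filter_upwards [hF0'] with v hv
    have hv' : 0 ≤ᵐ[volume] fun r => F (v, r) := hv
    have hint : Integrable fun r => F (v, r) :=
      (integrable_one_sub_cos_div ha hσl hσu hφ hm (bracket_pos v)).div_const (bracket v ^ (m + 1))
    exact (ofReal_integral_eq_lintegral_ofReal hint hv').symm
  · have hslice : ∀ v : En m, ¬ AEStronglyMeasurable fun r => F (v, r) := fun v h =>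
      hm <| aestronglyMeasurable_of_one_sub_cos_div (bracket_pos v).ne' <|
        (h.mul_const (bracket v ^ (m + 1))).congr <| .of_forall fun r =>
          div_mul_cancel₀ _ (pow_pos (bracket_pos v) _).ne'
    have hFm : ¬ AEStronglyMeasurable F (volume.prod volume) := fun h =>
      have ⟨v, hv⟩ := h.prodMk_left.exists
      hslice v hv
    rw [Measure.volume_eq_prod, integral_non_aestronglyMeasurable hFm]
    exact (integral_eq_zero_of_ae <| .of_forall fun v =>
      integral_non_aestronglyMeasurable (hslice v)).symm

theorem stmt9 (n : ℕ) (hn : 2 ≤ n) (φ : ℝ → ℝ) (a σl σu : ℝ) (ha : 1 ≤ a)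
    (hσl : 0 < σl) (hσ : σl ≤ σu) (hσu : σu < 2) (hφ : WSC φ a σl σu) :
    (@Cphi n ⟨by omega⟩ φ)⁻¹ =
      ∫ y' : En (n - 1),
        (∫ r : ℝ, (1 - Real.cos (r / Real.sqrt (1 + ‖y'‖ ^ 2))) / (|r| * φ |r|)) /
          (Real.sqrt (1 + ‖y'‖ ^ 2)) ^ n := by
  obtain ⟨m, rfl⟩ := Nat.exists_eq_add_of_le' (one_le_two.trans hn)
  rw [Cphi, inv_inv]
  exact integral_one_sub_cos_eq ha hσl hσu hφ
end
end

section
/- Barrier lemma: let κ₁ ∈ (0,1) and σ₀ ∈ (0,2), and assume σ̲ ≥ σ₀. There exist constants p > n+1 depending only on n, λ, Λ, and κ₀ ∈ (0, κ₁/8) depending only on n, λ, Λ, a, σ₀, such that for every R > 0 the function Φ₁(x) = min{(κ₀R)^{−p}, |x|^{−p}} satisfies M⁻Φ₁(x) ≥ 0 for all x ∈ B_R \ B_{κ₁R}. -/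
open MeasureTheory Metric Filter Set
open scoped Classical

noncomputable section

theorem two_add_sq_le_inv_pow_add_inv_pow (m : ℕ) {b : ℝ} (hb : |b| < 1) :
    2 + (m : ℝ) ^ 2 * b ^ 2 ≤ ((1 + b) ^ (2 * m))⁻¹ + ((1 - b) ^ (2 * m))⁻¹ := by
  wlog h0 : 0 ≤ b generalizing b
  · have h := this (b := -b) (by rwa [abs_neg]) (by linarith)
    rw [neg_sq, sub_neg_eq_add, ← sub_eq_add_neg] at h
    linarith
  have hb1 : b < 1 := (abs_lt.1 hb).2
  have h1 : (0 : ℝ) < 1 - b := by linarith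
  have h2 : (0 : ℝ) < 1 + b := by linarith
  rw [mul_comm 2 m, pow_mul, pow_mul, ← inv_pow ((1 + b) ^ m), ← inv_pow ((1 - b) ^ m)]
  set X := ((1 + b) ^ m)⁻¹ with hX
  set Y := ((1 - b) ^ m)⁻¹ with hY
  have hX1 : X ≤ 1 := inv_le_one_of_one_le₀ (one_le_pow₀ (by linarith))
  have hYb : 1 + m * b ≤ Y := by
    have e : 1 + b ≤ (1 - b)⁻¹ := by
      rw [le_inv_comm₀ h2 h1, ← one_div, le_div_iff₀ h2]; nlinarith
    calc 1 + m * b ≤ (1 + b) ^ m := one_add_mul_le_pow (by linarith) m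
      _ ≤ ((1 - b)⁻¹) ^ m := pow_le_pow_left₀ h2.le e m
      _ = Y := inv_pow _ _
  have hXY : 1 ≤ X * Y := by
    rw [hX, hY, ← mul_inv, ← mul_pow]
    exact (one_le_inv₀ (by positivity)).2 (pow_le_one₀ (by positivity) (by nlinarith))
  have hmb : 0 ≤ m * b := by positivity
  have : (m * b) ^ 2 ≤ (Y - X) ^ 2 := pow_le_pow_left₀ hmb (by linarith) 2
  nlinarith

theorem one_sub_mul_le_inv_pow (k : ℕ) {s : ℝ} (h0 : 0 ≤ s) (h1 : s ≤ 1) :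
    1 - k * s ≤ ((1 + s) ^ k)⁻¹ := by
  have e : 1 - s ≤ (1 + s)⁻¹ := by
    rw [← one_div, le_div_iff₀ (by linarith)]; nlinarith
  calc 1 - k * s = 1 + k * (-s) := by ring
    _ ≤ (1 + -s) ^ k := one_add_mul_le_pow (by linarith) k
    _ ≤ ((1 + s)⁻¹) ^ k := pow_le_pow_left₀ (by linarith) (by linarith) k
    _ = _ := inv_pow _ _

theorem quadratic_le_second_difference (m : ℕ) {s v : ℝ} (hs : 0 ≤ s) (hv : v ^ 2 ≤ s)
    (hms : (2 * m + 2) * s ≤ 1 / 2) :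
    2 * (m : ℝ) ^ 2 * v ^ 2 - 4 * m * s ≤
      ((1 + s + 2 * v) ^ (2 * m))⁻¹ + ((1 + s - 2 * v) ^ (2 * m))⁻¹ - 2 := by
  have hm : (0 : ℝ) ≤ m := Nat.cast_nonneg m
  have hs4 : s ≤ 1 / 4 := by nlinarith
  have hA : 0 < 1 + s := by linarith
  have hb : |2 * v / (1 + s)| < 1 := by
    rw [abs_div, abs_of_pos hA, div_lt_one hA]
    apply abs_lt_of_sq_lt_sq _ hA.le
    nlinarith
  have h := two_add_sq_le_inv_pow_add_inv_pow m hb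
  have e1 : 1 + s + 2 * v = (1 + s) * (1 + 2 * v / (1 + s)) := by field_simp
  have e2 : 1 + s - 2 * v = (1 + s) * (1 - 2 * v / (1 + s)) := by field_simp
  have hq := one_sub_mul_le_inv_pow (2 * m) hs (by linarith)
  have hq2 := one_sub_mul_le_inv_pow (2 * m + 2) hs (by linarith)
  have hhalf : 1 / 2 ≤ ((1 + s) ^ (2 * m + 2))⁻¹ := by
    push_cast at hq2; linarith
  have hpos : 0 ≤ ((1 + s) ^ (2 * m))⁻¹ := by positivity
  have e3 : ((1 + s) ^ (2 * m))⁻¹ * ((m : ℝ) ^ 2 * (2 * v / (1 + s)) ^ 2) =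
      4 * (m : ℝ) ^ 2 * v ^ 2 * ((1 + s) ^ (2 * m + 2))⁻¹ := by
    rw [pow_add]; field_simp; ring
  have h4 : 4 * (m : ℝ) ^ 2 * v ^ 2 * (1 / 2) ≤
      4 * (m : ℝ) ^ 2 * v ^ 2 * ((1 + s) ^ (2 * m + 2))⁻¹ :=
    mul_le_mul_of_nonneg_left hhalf (by positivity)
  have h5 := mul_le_mul_of_nonneg_left h hpos
  rw [e1, e2, mul_pow, mul_pow, mul_inv, mul_inv, ← mul_add]
  rw [mul_add, e3] at h5
  push_cast at hq
  linarith

theorem quadratic_le_second_difference_norm {E : Type*} [NormedAddCommGroup E]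
    [InnerProductSpace ℝ E] (m : ℕ) {η : ℝ} (hη : (2 * m + 2) * η ^ 2 ≤ 1 / 2) {x y : E}
    (hx : x ≠ 0) (hy : ‖y‖ ≤ η * ‖x‖) :
    (‖x‖ ^ (4 * m))⁻¹ * (‖x‖ ^ 4)⁻¹ *
        (2 * (m : ℝ) ^ 2 * inner ℝ x y ^ 2 - 4 * m * (‖x‖ ^ 2 * ‖y‖ ^ 2)) ≤
      (‖x + y‖ ^ (4 * m))⁻¹ + (‖x - y‖ ^ (4 * m))⁻¹ - 2 * (‖x‖ ^ (4 * m))⁻¹ := by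
  have hr : 0 < ‖x‖ := norm_pos_iff.2 hx
  set s := ‖y‖ ^ 2 / ‖x‖ ^ 2 with hs
  set v := inner ℝ x y / ‖x‖ ^ 2 with hv
  have hv2 : v ^ 2 ≤ s := by
    rw [hv, hs, div_pow, div_le_div_iff₀ (by positivity) (by positivity)]
    have h := pow_le_pow_left₀ (abs_nonneg _) (abs_real_inner_le_norm x y) 2
    rw [sq_abs, mul_pow] at h
    calc _ ≤ (‖x‖ ^ 2 * ‖y‖ ^ 2) * ‖x‖ ^ 2 := mul_le_mul_of_nonneg_right h (by positivity)
      _ = _ := by ring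
  have hsη : s ≤ η ^ 2 := by
    rw [hs, div_le_iff₀ (by positivity), ← mul_pow]
    exact pow_le_pow_left₀ (norm_nonneg _) hy 2
  have h := quadratic_le_second_difference m (by positivity) hv2
    ((mul_le_mul_of_nonneg_left hsη (by positivity)).trans hη)
  have e1 : ‖x + y‖ ^ (4 * m) = ‖x‖ ^ (4 * m) * (1 + s + 2 * v) ^ (2 * m) := by
    rw [show 4 * m = 2 * (2 * m) by ring, pow_mul _ 2 (2 * m), pow_mul _ 2 (2 * m), ← mul_pow,
      norm_add_sq_real]
    congr 1; rw [hs, hv]; field_simp; ring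
  have e2 : ‖x - y‖ ^ (4 * m) = ‖x‖ ^ (4 * m) * (1 + s - 2 * v) ^ (2 * m) := by
    rw [show 4 * m = 2 * (2 * m) by ring, pow_mul _ 2 (2 * m), pow_mul _ 2 (2 * m), ← mul_pow,
      norm_sub_sq_real]
    congr 1; rw [hs, hv]; field_simp; ring
  rw [e1, e2, mul_inv, mul_inv]
  calc _ = (‖x‖ ^ (4 * m))⁻¹ * (2 * (m : ℝ) ^ 2 * v ^ 2 - 4 * m * s) := by
        rw [hs, hv]; field_simp
    _ ≤ (‖x‖ ^ (4 * m))⁻¹ * _ := mul_le_mul_of_nonneg_left h (by positivity)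
    _ = _ := by ring

/-- The extremal function `min (lam t) (Lam t)` is superadditive and monotone. -/
theorem mul_sub_mul_le_extremal {lam Lam t t₁ t₂ : ℝ} (hlam : 0 < lam) (hlL : lam ≤ Lam)
    (h₁ : 0 ≤ t₁) (h₂ : 0 ≤ t₂) (ht : t₁ - t₂ ≤ t) :
    lam * t₁ - Lam * t₂ ≤ lam * max t 0 - Lam * max (-t) 0 := by
  rcases le_total 0 t with h | h
  · rw [max_eq_left h, max_eq_right (by linarith)]; nlinarith
  · rw [max_eq_right h, max_eq_left (by linarith)]; nlinarith

theorem Cphi_nonneg (n : ℕ) [NeZero n] {φ : ℝ → ℝ} (hφ : ∀ r : ℝ, 0 < r → 0 < φ r) :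
    0 ≤ Cphi n φ := by
  refine inv_nonneg.2 (integral_nonneg fun y => ?_)
  rcases eq_or_ne y 0 with rfl | hy
  · simp
  · have := hφ _ (norm_pos_iff.2 hy)
    exact div_nonneg (sub_nonneg.2 (Real.cos_le_one _)) (by positivity)

/-- The isometries sending the standard basis to the direction of `x`. -/
theorem exists_isometries_sum_inner_sq (n : ℕ) (x : En n) :
    ∃ S : Fin n → (En n ≃ₗᵢ[ℝ] En n),
      ∀ y, ∑ i, inner ℝ x (S i y) ^ 2 = ‖x‖ ^ 2 * ‖y‖ ^ 2 := by
  let e : Fin n → En n := fun i => ‖x‖ • EuclideanSpace.single i (1 : ℝ)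
  have he : ∀ i, ‖e i‖ = ‖x‖ := fun i => by simp [e, norm_smul]
  refine ⟨fun i => (Submodule.span ℝ {e i - x})ᗮ.reflection, fun y => ?_⟩
  have h : ∀ i, inner ℝ x ((Submodule.span ℝ {e i - x})ᗮ.reflection y) = ‖x‖ * y i := fun i => by
    have hS : (Submodule.span ℝ {e i - x})ᗮ.reflection (e i) = x :=
      Submodule.reflection_sub (he i)
    conv_lhs => arg 2; rw [← hS]
    rw [LinearIsometryEquiv.inner_map_map]
    simp [e, inner_smul_left, EuclideanSpace.inner_single_left]
  simp_rw [h, mul_pow]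
  rw [← Finset.mul_sum, EuclideanSpace.norm_sq_eq y]
  simp

theorem setIntegral_ball_nonneg_of_sum_isometries {n : ℕ} [NeZero n] {G : En n → ℝ}
    (hG : Integrable G) (S : Fin n → (En n ≃ₗᵢ[ℝ] En n)) {ρ : ℝ}
    (h : ∀ y ∈ ball (0 : En n) ρ, 0 ≤ ∑ i, G (S i y)) :
    0 ≤ ∫ y in ball (0 : En n) ρ, G y := by
  have hpre : ∀ i, S i ⁻¹' ball (0 : En n) ρ = ball 0 ρ := fun i => by
    ext y; simp
  have hi : ∀ i, ∫ y in ball (0 : En n) ρ, G (S i y) = ∫ y in ball (0 : En n) ρ, G y := fun i => by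
    have := (S i).measurePreserving.setIntegral_preimage_emb
      (S i).toHomeomorph.measurableEmbedding G (ball 0 ρ)
    rwa [hpre] at this
  have hint : ∀ i, IntegrableOn (fun y => G (S i y)) (ball (0 : En n) ρ) := fun i =>
    ((S i).measurePreserving.integrable_comp_of_integrable hG).integrableOn
  have hsum : ∑ i, ∫ y in ball (0 : En n) ρ, G (S i y) = n * ∫ y in ball (0 : En n) ρ, G y := by
    simp [hi]
  rw [← integral_finsetSum _ fun i _ => hint i] at hsum
  have h0 : 0 ≤ (n : ℝ) * ∫ y in ball (0 : En n) ρ, G y := by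
    rw [← hsum]; exact setIntegral_nonneg measurableSet_ball h
  exact nonneg_of_mul_nonneg_right h0 (Nat.cast_pos.2 (NeZero.pos n))

/-- The power `‖z‖ ^ (-k)` truncated inside the ball of radius `c`. -/
def truncatedPower {n : ℕ} (k : ℕ) (c : ℝ) (z : En n) : ℝ :=
  min (c ^ k)⁻¹ (‖z‖ ^ k)⁻¹

theorem min_rpow_eq_truncatedPower {n : ℕ} (m : ℕ) {c : ℝ} (hc : 0 ≤ c) :
    (fun z : En n => min (c ^ (-(4 * m : ℝ))) (‖z‖ ^ (-(4 * m : ℝ)))) =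
      truncatedPower (4 * m) c := by
  have h : ∀ t : ℝ, 0 ≤ t → t ^ (-(4 * m : ℝ)) = (t ^ (4 * m))⁻¹ := fun t ht => by
    rw [Real.rpow_neg ht, ← Real.rpow_natCast]; push_cast; rfl
  ext z
  rw [h c hc, h _ (norm_nonneg z), truncatedPower]

theorem truncatedPower_nonneg {n : ℕ} (k : ℕ) {c : ℝ} (hc : 0 ≤ c) (z : En n) :
    0 ≤ truncatedPower k c z :=
  le_min (by positivity) (by positivity)

theorem truncatedPower_of_le_norm {n : ℕ} (k : ℕ) {c : ℝ} (hc : 0 < c) {z : En n}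
    (hz : c ≤ ‖z‖) : truncatedPower k c z = (‖z‖ ^ k)⁻¹ :=
  min_eq_right (inv_anti₀ (by positivity) (pow_le_pow_left₀ hc.le hz k))

theorem truncatedPower_of_norm_le {n : ℕ} (k : ℕ) {c : ℝ} {z : En n} (hz0 : z ≠ 0)
    (hz : ‖z‖ ≤ c) : truncatedPower k c z = (c ^ k)⁻¹ :=
  min_eq_left (inv_anti₀ (pow_pos (norm_pos_iff.2 hz0) k) (pow_le_pow_left₀ (norm_nonneg z) hz k))

theorem WSC.kernel_le {φ : ℝ → ℝ} {a σl σu σ0 ρ t : ℝ} (hφ : WSC φ a σl σu) (ha : 0 < a)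
    (hσ0 : 0 < σ0) (hσ : σ0 ≤ σl) (hρ : 0 < ρ) (ht : ρ ≤ t) (n : ℕ) :
    1 / (t ^ n * φ t) ≤
      a * 2 ^ (n + σ0) * (ρ ^ n * φ ρ)⁻¹ * (1 + t / ρ) ^ (-(n + σ0)) := by
  have hρφ := hφ.1 ρ hρ
  have ht0 := hρ.trans_le ht
  have htφ := hφ.1 t ht0
  set τ := t / ρ with hτ
  have hτ1 : 1 ≤ τ := (one_le_div hρ).2 ht
  have h1 : a⁻¹ * τ ^ σ0 ≤ φ t / φ ρ :=
    (mul_le_mul_of_nonneg_left (Real.rpow_le_rpow_of_exponent_le hτ1 hσ) (by positivity)).trans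
      (hφ.2 ρ t hρ ht).1
  rw [le_div_iff₀ hρφ] at h1
  have h2 : ((1 + τ) / 2) ^ (n + σ0) ≤ τ ^ n * τ ^ σ0 := by
    rw [← Real.rpow_natCast τ n, ← Real.rpow_add (by positivity)]
    exact Real.rpow_le_rpow (by positivity) (by linarith) (by positivity)
  have htn : t ^ n = ρ ^ n * τ ^ n := by rw [← mul_pow, hτ]; congr 1; field_simp
  have h3 : ((1 + τ) / 2) ^ (n + σ0) * (a⁻¹ * (ρ ^ n * φ ρ)) ≤ t ^ n * φ t := by
    calc _ ≤ τ ^ n * τ ^ σ0 * (a⁻¹ * (ρ ^ n * φ ρ)) :=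
          mul_le_mul_of_nonneg_right h2 (by positivity)
      _ = ρ ^ n * τ ^ n * (a⁻¹ * τ ^ σ0 * φ ρ) := by ring
      _ ≤ ρ ^ n * τ ^ n * φ t := mul_le_mul_of_nonneg_left h1 (by positivity)
      _ = _ := by rw [htn]
  refine (one_div_le_one_div_of_le (by positivity) h3).trans (le_of_eq ?_)
  rw [Real.div_rpow (by positivity) (by norm_num), Real.rpow_neg (by positivity)]
  field_simp

theorem WSC.le_kernel {φ : ℝ → ℝ} {a σl σu ρ t M : ℝ} (hφ : WSC φ a σl σu) (ha : 0 < a)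
    (hσ : σu ≤ 2) (hρ : 0 < ρ) (ht : ρ ≤ t) (hM : t / ρ ≤ M) (n : ℕ) :
    (a * M ^ (n + 2))⁻¹ * (ρ ^ n * φ ρ)⁻¹ ≤ 1 / (t ^ n * φ t) := by
  have hρφ := hφ.1 ρ hρ
  have ht0 := hρ.trans_le ht
  have htφ := hφ.1 t ht0
  set τ := t / ρ with hτ
  have hτ1 : 1 ≤ τ := (one_le_div hρ).2 ht
  have h1 : φ t / φ ρ ≤ a * τ ^ 2 := by
    refine (hφ.2 ρ t hρ ht).2.trans (mul_le_mul_of_nonneg_left ?_ ha.le)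
    rw [← Real.rpow_natCast τ 2]
    exact Real.rpow_le_rpow_of_exponent_le hτ1 (by simpa using hσ)
  rw [div_le_iff₀ hρφ] at h1
  have htn : t ^ n = ρ ^ n * τ ^ n := by rw [← mul_pow, hτ]; congr 1; field_simp
  rw [← mul_inv, ← one_div]
  refine one_div_le_one_div_of_le (by positivity) ?_
  calc t ^ n * φ t ≤ t ^ n * (a * τ ^ 2 * φ ρ) := mul_le_mul_of_nonneg_left h1 (by positivity)
    _ = a * τ ^ (n + 2) * (ρ ^ n * φ ρ) := by rw [htn]; ring
    _ ≤ a * M ^ (n + 2) * (ρ ^ n * φ ρ) := by gcongr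

/-- The mass of the decaying kernel dominating the tail of the scaled kernels. -/
def tailMass (n : ℕ) (σ : ℝ) : ℝ := ∫ z : En n, (1 + ‖z‖) ^ (-(n + σ))

theorem tailMass_nonneg (n : ℕ) (σ : ℝ) : 0 ≤ tailMass n σ :=
  integral_nonneg fun z => by positivity

theorem integrable_tail (n : ℕ) {σ : ℝ} (hσ : 0 < σ) :
    Integrable fun z : En n => (1 + ‖z‖) ^ (-(n + σ)) :=
  integrable_one_add_norm (by simpa using hσ)

theorem norm_inv_smul_eq_div {n : ℕ} {ρ : ℝ} (hρ : 0 < ρ) (y : En n) : ‖ρ⁻¹ • y‖ = ‖y‖ / ρ := by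
  rw [norm_smul, norm_inv, Real.norm_of_nonneg hρ.le]; ring

theorem integrable_scaled_tail (n : ℕ) {σ ρ : ℝ} (hσ : 0 < σ) (hρ : 0 < ρ) :
    Integrable fun y : En n => (1 + ‖y‖ / ρ) ^ (-(n + σ)) := by
  simpa only [norm_inv_smul_eq_div hρ] using
    (integrable_tail n hσ).comp_smul (R := ρ⁻¹) (by positivity)

theorem integral_scaled_tail (n : ℕ) {σ ρ : ℝ} (hρ : 0 < ρ) :
    ∫ y : En n, (1 + ‖y‖ / ρ) ^ (-(n + σ)) = ρ ^ n * tailMass n σ := by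
  have h := Measure.integral_comp_smul (volume : Measure (En n))
    (fun z : En n => (1 + ‖z‖) ^ (-(n + σ))) ρ⁻¹
  simp only [norm_inv_smul_eq_div hρ] at h
  rw [h, tailMass]
  simp [abs_of_pos hρ]

theorem exists_far_constant (n : ℕ) [NeZero n] {lam Lam a η σ0 : ℝ} (hlam : 0 < lam)
    (hLam : 0 ≤ Lam) (ha : 0 < a) (hη : 0 < η) {k : ℕ} (hk : n < k) :
    ∃ ε : ℝ, 0 < ε ∧ ε < 1 / 8 ∧ ∀ {r c : ℝ}, 0 < r → 0 < c → c ≤ ε * r →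
      2 * Lam * (r ^ k)⁻¹ * (a * 2 ^ (n + σ0)) * ((η * r) ^ n * tailMass n σ0) ≤
        lam * (c ^ k)⁻¹ * (a * (2 / η) ^ (n + 2))⁻¹ * (c ^ n * volume.real (ball (0 : En n) 1)) := by
  set ω := volume.real (ball (0 : En n) 1) with hω
  have hω0 : 0 < ω := ENNReal.toReal_pos (measure_ball_pos _ _ one_pos).ne' measure_ball_lt_top.ne
  set C := 2 * Lam * (a * 2 ^ (n + σ0)) * (η ^ n * tailMass n σ0) with hC
  set B := lam * (a * (2 / η) ^ (n + 2))⁻¹ * ω with hB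
  have hC0 : 0 ≤ C := by have := tailMass_nonneg n σ0; positivity
  have hB0 : 0 < B := by positivity
  have hCB : 0 ≤ C / B := by positivity
  refine ⟨1 / (9 + C / B), by positivity,
    one_div_lt_one_div_of_lt (by norm_num) (by linarith), fun {r c} hr hc hcr => ?_⟩
  obtain ⟨d, rfl⟩ := Nat.exists_eq_add_of_lt hk
  have hε1 : 1 / (9 + C / B) ≤ 1 := (div_le_one (by positivity)).2 (by linarith)
  have hwε : c / r ≤ 1 / (9 + C / B) := (div_le_iff₀ hr).2 hcr
  have hw : (c / r) ^ (d + 1) ≤ 1 / (9 + C / B) :=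
    (pow_le_of_le_one (by positivity) (hwε.trans hε1) (by omega)).trans hwε
  have h1 : C * (c / r) ^ (d + 1) ≤ B := by
    calc _ ≤ C * (1 / (9 + C / B)) := mul_le_mul_of_nonneg_left hw hC0
      _ ≤ B := by
        rw [mul_one_div, div_le_iff₀ (by positivity), mul_add, mul_div_cancel₀ _ hB0.ne']
        linarith
  calc _ = (c ^ (d + 1))⁻¹ * (C * (c / r) ^ (d + 1)) := by
        rw [hC]; simp only [pow_add, div_pow, mul_pow]; field_simp
    _ ≤ (c ^ (d + 1))⁻¹ * B := mul_le_mul_of_nonneg_left h1 (by positivity)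
    _ = _ := by
        rw [hB]; simp only [pow_add]; field_simp

theorem Mm_truncatedPower_nonneg {n m : ℕ} [NeZero n] {lam Lam a η σ0 σl σu c : ℝ}
    (hlam : 0 < lam) (hlL : lam ≤ Lam) (hm : 2 * n * Lam ≤ m * lam) (hη0 : 0 < η)
    (hη2 : η ≤ 1 / 2) (hη : (2 * m + 2) * η ^ 2 ≤ 1 / 2) (ha : 1 ≤ a) (hσl : σ0 ≤ σl)
    (hσu : σu ≤ 2) {φ : ℝ → ℝ} (hφ : WSC φ a σl σu) {x : En n} (hx : x ≠ 0) (hc : 0 < c)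
    (hcx : c ≤ 1 / 8 * ‖x‖) (hσ0 : 0 < σ0)
    (hfar : 2 * Lam * (‖x‖ ^ (4 * m))⁻¹ * (a * 2 ^ (n + σ0)) *
        ((η * ‖x‖) ^ n * tailMass n σ0) ≤
      lam * (c ^ (4 * m))⁻¹ * (a * (2 / η) ^ (n + 2))⁻¹ *
        (c ^ n * volume.real (ball (0 : En n) 1))) :
    0 ≤ Mm n φ lam Lam (truncatedPower (4 * m) c) x := by
  have hLam : 0 < Lam := hlam.trans_le hlL
  have ha0 : 0 < a := zero_lt_one.trans_le ha
  have hr : 0 < ‖x‖ := norm_pos_iff.2 hx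
  have hux : truncatedPower (4 * m) c x = (‖x‖ ^ (4 * m))⁻¹ :=
    truncatedPower_of_le_norm _ hc (by linarith)
  refine mul_nonneg (Cphi_nonneg n hφ.1) ?_
  set G : En n → ℝ := fun y => (lam * max (dd (truncatedPower (4 * m) c) x y) 0 -
    Lam * max (-(dd (truncatedPower (4 * m) c) x y)) 0) / (‖y‖ ^ n * φ ‖y‖) with hGdef
  by_cases hG : Integrable G
  swap
  · rw [integral_undef hG]
  set ρ := η * ‖x‖ with hρ
  have hρ0 : 0 < ρ := by positivity
  have hK : ∀ y : En n, 0 ≤ ‖y‖ ^ n * φ ‖y‖ := fun y => by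
    rcases eq_or_ne y 0 with rfl | hy
    · simp [NeZero.ne n]
    · have := hφ.1 _ (norm_pos_iff.2 hy)
      positivity
  rw [← integral_add_compl (measurableSet_ball (x := (0 : En n)) (ε := ρ)) hG]
  refine add_nonneg ?_ ?_
  · obtain ⟨S, hS⟩ := exists_isometries_sum_inner_sq n x
    refine setIntegral_ball_nonneg_of_sum_isometries hG S fun y hy => ?_
    have hyρ : ‖y‖ ≤ η * ‖x‖ := by simpa using (mem_ball_zero_iff.1 hy).le
    set T := (‖x‖ ^ (4 * m))⁻¹ * (‖x‖ ^ 4)⁻¹ with hT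
    have hT0 : 0 ≤ T := by positivity
    have hpt : ∀ i, lam * (T * (2 * (m : ℝ) ^ 2 * inner ℝ x (S i y) ^ 2)) -
        Lam * (T * (4 * m * (‖x‖ ^ 2 * ‖y‖ ^ 2))) ≤
        lam * max (dd (truncatedPower (4 * m) c) x (S i y)) 0 -
          Lam * max (-(dd (truncatedPower (4 * m) c) x (S i y))) 0 := fun i => by
      refine mul_sub_mul_le_extremal hlam hlL (by positivity) (by positivity) ?_
      have hSy : ‖S i y‖ = ‖y‖ := (S i).norm_map y
      have h := quadratic_le_second_difference_norm m hη hx (y := S i y) (by rwa [hSy])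
      have hadd : c ≤ ‖x + S i y‖ := by
        have := norm_sub_le (x + S i y) (S i y)
        rw [add_sub_cancel_right, hSy] at this
        nlinarith
      have hsub : c ≤ ‖x - S i y‖ := by
        have := norm_sub_norm_le x (S i y)
        rw [hSy] at this
        nlinarith
      rw [dd, truncatedPower_of_le_norm _ hc hadd, truncatedPower_of_le_norm _ hc hsub, hux]
      rw [hSy, mul_sub] at h
      exact h
    have hsum := Finset.sum_le_sum fun i (_ : i ∈ Finset.univ) => hpt i
    rw [Finset.sum_sub_distrib, ← Finset.mul_sum, ← Finset.mul_sum, ← Finset.mul_sum, hS,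
      Finset.sum_const, Finset.card_univ, Fintype.card_fin, nsmul_eq_mul] at hsum
    simp only [hGdef, LinearIsometryEquiv.norm_map]
    rw [← Finset.sum_div]
    refine div_nonneg (le_trans ?_ hsum) (hK y)
    have h1 : 0 ≤ T * (2 * m * (‖x‖ ^ 2 * ‖y‖ ^ 2)) * (m * lam - 2 * n * Lam) :=
      mul_nonneg (by positivity) (by linarith)
    linarith
  · have hρφ := hφ.1 ρ hρ0
    set D := (ρ ^ n * φ ρ)⁻¹ with hD
    have hD0 : 0 < D := by positivity
    set c₁ := lam * (c ^ (4 * m))⁻¹ * (a * (2 / η) ^ (n + 2))⁻¹ with hc₁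
    set c₂ := 2 * Lam * (‖x‖ ^ (4 * m))⁻¹ * (a * 2 ^ (n + σ0)) with hc₂
    have hc₂0 : 0 ≤ c₂ := by positivity
    set g₁ : En n → ℝ := (ball (-x) c).indicator fun _ => D * c₁ with hg₁
    set g₂ : En n → ℝ := fun y => D * c₂ * (1 + ‖y‖ / ρ) ^ (-(n + σ0)) with hg₂
    have hball : ∀ y ∈ ball (-x) c, ρ ≤ ‖y‖ ∧ ‖y‖ / ρ ≤ 2 / η := fun y hy => by
      have hxy : ‖y + x‖ < c := by rwa [mem_ball_iff_norm, sub_neg_eq_add] at hy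
      have h1 := norm_sub_le (y + x) y
      have h2 := norm_sub_le (y + x) x
      rw [add_sub_cancel_left] at h1
      rw [add_sub_cancel_right] at h2
      refine ⟨by nlinarith, ?_⟩
      rw [hρ, div_le_div_iff₀ (by positivity) hη0]
      nlinarith
    have hi₁ : Integrable g₁ :=
      (integrable_indicator_iff measurableSet_ball).2 (integrableOn_const measure_ball_lt_top.ne)
    have hi₂ : Integrable g₂ := (integrable_scaled_tail n hσ0 hρ0).const_mul _
    have hle : ∫ y in (ball (0 : En n) ρ)ᶜ, (g₁ y - g₂ y) ≤ ∫ y in (ball (0 : En n) ρ)ᶜ, G y := by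
      refine setIntegral_mono_on_ae (hi₁.sub hi₂).integrableOn hG.integrableOn
        measurableSet_ball.compl ?_
      filter_upwards [Measure.ae_ne volume (-x)] with y hyx hy
      have hyρ : ρ ≤ ‖y‖ := by simpa using hy
      have hy0 : 0 < ‖y‖ := hρ0.trans_le hyρ
      have hyφ := hφ.1 _ hy0
      have hup := hφ.kernel_le ha0 hσ0 hσl hρ0 hyρ n
      have hu := truncatedPower_nonneg (n := n) (4 * m) hc.le
      have hext := mul_sub_mul_le_extremal hlam hlL (hu (x + y))
        (t₂ := 2 * (‖x‖ ^ (4 * m))⁻¹) (t := dd (truncatedPower (4 * m) c) x y)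
        (by positivity) (by rw [dd, hux]; linarith [hu (x - y)])
      have hGy : (lam * truncatedPower (4 * m) c (x + y)) * (1 / (‖y‖ ^ n * φ ‖y‖)) -
          2 * Lam * (‖x‖ ^ (4 * m))⁻¹ * (1 / (‖y‖ ^ n * φ ‖y‖)) ≤ G y := by
        rw [← sub_mul, mul_one_div]
        refine div_le_div_of_nonneg_right (le_trans (le_of_eq ?_) hext) (hK y)
        ring
      refine le_trans (sub_le_sub ?_ ?_) hGy
      · by_cases hyb : y ∈ ball (-x) c
        · have hxy0 : x + y ≠ 0 := fun h => hyx (eq_neg_of_add_eq_zero_right h)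
          have hxy : ‖x + y‖ ≤ c := by
            have : ‖y + x‖ < c := by rwa [mem_ball_iff_norm, sub_neg_eq_add] at hyb
            rw [add_comm]; exact this.le
          rw [hg₁, indicator_of_mem hyb, truncatedPower_of_norm_le _ hxy0 hxy]
          have := mul_le_mul_of_nonneg_left
            (hφ.le_kernel ha0 hσu hρ0 hyρ (hball y hyb).2 n)
            (by positivity : 0 ≤ lam * (c ^ (4 * m))⁻¹)
          refine le_trans (le_of_eq ?_) this
          rw [hc₁, hD]; ring
        · rw [hg₁, indicator_of_notMem hyb]
          have := hu (x + y)
          positivity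
      · refine (mul_le_mul_of_nonneg_left hup (by positivity)).trans (le_of_eq ?_)
        rw [hg₂, hc₂, hD]; ring
    refine le_trans ?_ hle
    rw [integral_sub hi₁.integrableOn hi₂.integrableOn]
    have hI₂ : ∫ y in (ball (0 : En n) ρ)ᶜ, g₂ y ≤ D * c₂ * (ρ ^ n * tailMass n σ0) := by
      rw [← integral_scaled_tail n hρ0, ← integral_const_mul]
      exact setIntegral_le_integral hi₂ (Eventually.of_forall fun y => by
        simp only [hg₂, Pi.zero_apply]; positivity)
    have hI₁ : ∫ y in (ball (0 : En n) ρ)ᶜ, g₁ y =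
        D * c₁ * (c ^ n * volume.real (ball (0 : En n) 1)) := by
      have hsub : ball (-x) c ⊆ (ball (0 : En n) ρ)ᶜ := fun y hy => by
        simpa using (hball y hy).1
      rw [hg₁, setIntegral_indicator measurableSet_ball, inter_eq_right.2 hsub,
        setIntegral_const, measureReal_def, Measure.addHaar_ball_of_pos _ _ hc,
        ENNReal.toReal_mul, ENNReal.toReal_ofReal (by positivity), finrank_euclideanSpace_fin,
        smul_eq_mul, measureReal_def, mul_comm]
    rw [hI₁]
    have := mul_le_mul_of_nonneg_left hfar hD0.le
    linarith

theorem stmt13 (n : ℕ) [NeZero n] (lam Lam : ℝ) (hlam : 0 < lam) (hlL : lam ≤ Lam) :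
    ∃ p > (n : ℝ) + 1, ∀ a : ℝ, 1 ≤ a → ∀ σ0 ∈ Ioo (0:ℝ) 2, ∀ κ1 ∈ Ioo (0:ℝ) 1,
      ∃ κ0 ∈ Ioo (0:ℝ) (κ1 / 8),
        ∀ σl σu : ℝ, σ0 ≤ σl → σl ≤ σu → σu < 2 →
        ∀ φ : ℝ → ℝ, WSC φ a σl σu → ∀ R : ℝ, 0 < R →
        ∀ x ∈ ball (0 : En n) R \ ball (0 : En n) (κ1 * R),
          0 ≤ Mm n φ lam Lam (fun z => min ((κ0 * R) ^ (-p)) (‖z‖ ^ (-p))) x := by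
  obtain ⟨m, hm⟩ := exists_nat_ge (2 * n * (Lam / lam))
  have hn1 : (1 : ℝ) ≤ n := by exact_mod_cast NeZero.one_le
  have hq : 1 ≤ Lam / lam := (one_le_div hlam).2 hlL
  have hm2 : (2 * n : ℝ) ≤ m := by nlinarith
  have hmn : 2 * n ≤ m := by exact_mod_cast hm2
  have hn0 : 1 ≤ n := NeZero.one_le
  have hmL : 2 * n * Lam ≤ m * lam := by
    rw [← mul_div_assoc, div_le_iff₀ hlam] at hm; exact hm
  refine ⟨4 * m, by linarith, fun a ha σ0 hσ0 κ1 hκ1 => ?_⟩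
  set η : ℝ := 1 / (2 * m + 2) with hη
  have hη0 : 0 < η := by positivity
  have hη2 : η ≤ 1 / 2 := one_div_le_one_div_of_le (by norm_num) (by linarith)
  have hηm : (2 * m + 2) * η ^ 2 ≤ 1 / 2 := by
    have : (2 * m + 2) * η = 1 := by rw [hη]; field_simp
    nlinarith
  obtain ⟨ε, hε0, hε8, hε⟩ := exists_far_constant n hlam (hlam.trans_le hlL).le
    (zero_lt_one.trans_le ha) hη0 (σ0 := σ0) (k := 4 * m) (by omega)
  refine ⟨κ1 * ε, ⟨mul_pos hκ1.1 hε0, by nlinarith [hκ1.1]⟩, ?_⟩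
  intro σl σu hσl _ hσu φ hφ R hR x hx
  have hr : κ1 * R ≤ ‖x‖ := by simpa using hx.2
  have hr0 : 0 < ‖x‖ := (mul_pos hκ1.1 hR).trans_le hr
  have hx0 : x ≠ 0 := norm_pos_iff.1 hr0
  have hc0 : 0 < κ1 * ε * R := mul_pos (mul_pos hκ1.1 hε0) hR
  have hcr : κ1 * ε * R ≤ ε * ‖x‖ := by nlinarith
  rw [min_rpow_eq_truncatedPower m hc0.le]
  exact Mm_truncatedPower_nonneg hlam hlL hmL hη0 hη2 hηm ha hσl hσu.le hφ hx0 hc0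
    (hcr.trans (by nlinarith)) hσ0.1 (hε hr0 hc0 hcr)
end
end
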